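/- Let f be a probability density function on ℝ^m with mean vector μ ∈ ℝ^m and symmetric positive definite covariance matrix Σ. Then the differential Shannon entropy of f satisfies H(f) ≤ (1/2) log((2πe)^m det(Σ)), with equality if and only if f equals the multivariate Gaussian density φ_{μ,Σ} Lebesgue-almost everywhere. -/

import Mathlib

open MeasureTheory Filter Matrix ProbabilityTheory
open scoped ENNReal Topology

noncomputable section

/-- Differential Shannon entropy of a density on `ℝ^m`. -/
def shannonEntropy {m : ℕ} (f : EuclideanSpace ℝ (Fin m) → ℝ) : ℝ :=
  -∫ x, f x * Real.log (f x)

/-- Kullback–Leibler divergence between two densities on `ℝ^m`. -/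
def klDiv {m : ℕ} (f g : EuclideanSpace ℝ (Fin m) → ℝ) : ℝ :=
  ∫ x, f x * Real.log (f x / g x)

/-- The multivariate Gaussian density with mean `μ` and covariance `S`. -/
def gaussianDensity {m : ℕ} (μ : EuclideanSpace ℝ (Fin m))
    (S : Matrix (Fin m) (Fin m) ℝ) (x : EuclideanSpace ℝ (Fin m)) : ℝ :=
  (2 * Real.pi) ^ (-(m : ℝ) / 2) * S.det ^ (-(1 : ℝ) / 2) *
    Real.exp (-(1 / 2) * ((fun i => x i - μ i) ⬝ᵥ (S⁻¹ *ᵥ fun i => x i - μ i)))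

/-- `f` is a probability density function on `ℝ^m` (w.r.t. Lebesgue measure). -/
def IsDensity {m : ℕ} (f : EuclideanSpace ℝ (Fin m) → ℝ) : Prop :=
  Measurable f ∧ (∀ x, 0 ≤ f x) ∧ Integrable f ∧ ∫ x, f x = 1

/-- The density `f` has mean vector `μ` (all first moments exist). -/
def HasMean {m : ℕ} (f : EuclideanSpace ℝ (Fin m) → ℝ)
    (μ : EuclideanSpace ℝ (Fin m)) : Prop :=
  (∀ i, Integrable fun x => f x * x i) ∧ ∀ i, (∫ x, f x * x i) = μ i

/-- The density `f` with mean `μ` has covariance matrix `S`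
(all second moments exist). -/
def HasCov {m : ℕ} (f : EuclideanSpace ℝ (Fin m) → ℝ)
    (μ : EuclideanSpace ℝ (Fin m)) (S : Matrix (Fin m) (Fin m) ℝ) : Prop :=
  (∀ i j, Integrable fun x => f x * ((x i - μ i) * (x j - μ j))) ∧
    ∀ i j, (∫ x, f x * ((x i - μ i) * (x j - μ j))) = S i j

/-- The `k`-th smallest element of a multiset of reals (`k = 1` is the minimum). -/
def kthSmallest (s : Multiset ℝ) (k : ℕ) : ℝ :=
  (s.sort (· ≤ ·)).getD (k - 1) 0

/-- `ρ_{i,k,N}`: Euclidean distance from `X i` to its `k`-th nearest neighbour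
among `{X j : j ≠ i, j < N}`. -/
def nnDist {m : ℕ} (X : ℕ → EuclideanSpace ℝ (Fin m)) (i k N : ℕ) : ℝ :=
  kthSmallest (((Finset.range N).erase i).val.map fun j => dist (X i) (X j)) k

/-- `ν_{i,k}`: Euclidean distance from `X i` to its `k`-th nearest neighbour
among `{Y j : j < M}`. -/
def nnDistTo {m : ℕ} (X Y : ℕ → EuclideanSpace ℝ (Fin m)) (i k M : ℕ) : ℝ :=
  kthSmallest ((Finset.range M).val.map fun j => dist (X i) (Y j)) k

/-- The digamma function `ψ = (log ∘ Γ)'`. -/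
def digamma (x : ℝ) : ℝ := deriv (fun y => Real.log (Real.Gamma y)) x

/-- Volume of the unit Euclidean ball in `ℝ^m`, `V_m = π^(m/2) / Γ(m/2 + 1)`. -/
def unitBallVol (m : ℕ) : ℝ := Real.pi ^ ((m : ℝ) / 2) / Real.Gamma ((m : ℝ) / 2 + 1)

/-- The Kozachenko–Leonenko `k`-nearest-neighbour entropy estimator
`Ĥ_{N,k} = ψ(N) - ψ(k) + log V_m + (m/N) ∑_{i<N} log ρ_{i,k,N}`. -/
def entropyEstimator {m : ℕ} (k N : ℕ) (X : ℕ → EuclideanSpace ℝ (Fin m)) : ℝ :=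
  digamma N - digamma k + Real.log (unitBallVol m) +
    ((m : ℝ) / N) * ∑ i ∈ Finset.range N, Real.log (nnDist X i k N)

/-- The `k`-nearest-neighbour KL divergence estimator
`D̂ = (m/N) ∑_{i<N} log (ν_{i,k} / ρ_{i,k,N}) + ψ(M) - ψ(N-1)`. -/
def klDivEstimator {m : ℕ} (k N M : ℕ) (X Y : ℕ → EuclideanSpace ℝ (Fin m)) : ℝ :=
  ((m : ℝ) / N) * ∑ i ∈ Finset.range N, Real.log (nnDistTo X Y i k M / nnDist X i k N) +
    digamma M - digamma (N - 1)

/-- The sample mean `X̄_N`. -/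
def sampleMean {m : ℕ} (N : ℕ) (X : ℕ → EuclideanSpace ℝ (Fin m)) :
    EuclideanSpace ℝ (Fin m) :=
  (N : ℝ)⁻¹ • ∑ i ∈ Finset.range N, X i

/-- The sample covariance matrix `S_N`. -/
def sampleCov {m : ℕ} (N : ℕ) (X : ℕ → EuclideanSpace ℝ (Fin m)) :
    Matrix (Fin m) (Fin m) ℝ :=
  fun a b => ((N : ℝ) - 1)⁻¹ *
    ∑ i ∈ Finset.range N, (X i a - sampleMean N X a) * (X i b - sampleMean N X b)

/-- The KL-based test statistic
`T_{N,k} = (1/2) log ((2πe)^m det S_N) - Ĥ_{N,k}`. -/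
def klTestStat {m : ℕ} (k N : ℕ) (X : ℕ → EuclideanSpace ℝ (Fin m)) : ℝ :=
  (1 / 2) * Real.log ((2 * Real.pi * Real.exp 1) ^ m * (sampleCov N X).det) -
    entropyEstimator k N X

/-- Change of variables for an invertible linear endomorphism. -/
lemma integral_comp_linearMap_eq {E : Type*} [NormedAddCommGroup E] [NormedSpace ℝ E]
    [MeasurableSpace E] [BorelSpace E] [FiniteDimensional ℝ E] (ν : Measure E)
    [ν.IsAddHaarMeasure] {L : E →ₗ[ℝ] E} (hL : LinearMap.det L ≠ 0) (F : E → ℝ) :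
    ∫ x, F (L x) ∂ν = |(LinearMap.det L)⁻¹| * ∫ x, F x ∂ν := by
  have he : MeasurableEmbedding L :=
    (L.equivOfDetNeZero hL).toContinuousLinearEquiv.toHomeomorph.measurableEmbedding
  rw [← he.integral_map, Measure.map_linearMap_addHaar_eq_smul_addHaar ν hL, integral_smul_measure,
    ENNReal.toReal_ofReal (abs_nonneg _), smul_eq_mul]

lemma Matrix.PosSemidef.exists_eq_transpose_mul_self {n : Type*} [Fintype n] [DecidableEq n]
    {A : Matrix n n ℝ} (hA : A.PosSemidef) : ∃ B : Matrix n n ℝ, A = Bᵀ * B := by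
  open scoped MatrixOrder in
  obtain ⟨B, hB⟩ := CStarAlgebra.nonneg_iff_eq_star_mul_self.mp hA.nonneg
  exact ⟨B, by rw [hB, star_eq_conjTranspose, conjTranspose_eq_transpose_of_trivial]⟩

/-- The integral of a centred Gaussian function with positive definite quadratic form. -/
lemma integral_exp_neg_half_quadratic {m : ℕ} {A : Matrix (Fin m) (Fin m) ℝ} (hA : A.PosDef) :
    ∫ x : EuclideanSpace ℝ (Fin m), Real.exp (-(1 / 2) * (x.ofLp ⬝ᵥ (A *ᵥ x.ofLp))) =
      (2 * Real.pi) ^ ((m : ℝ) / 2) * A.det ^ (-(1 : ℝ) / 2) := by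
  obtain ⟨B, hB⟩ := hA.posSemidef.exists_eq_transpose_mul_self
  have hdet : A.det = B.det ^ 2 := by rw [hB, det_mul, det_transpose, sq]
  have hB0 : B.det ≠ 0 := fun h => hA.det_pos.ne' (by rw [hdet, h]; simp)
  have hquad (x : EuclideanSpace ℝ (Fin m)) :
      x.ofLp ⬝ᵥ (A *ᵥ x.ofLp) = ‖B.toLpLin 2 2 x‖ ^ 2 := by
    rw [EuclideanSpace.real_norm_sq_eq, hB, ← mulVec_mulVec, mulVec_transpose,
      dotProduct_comm, ← dotProduct_mulVec]
    simp [dotProduct, sq]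
  simp_rw [hquad]
  have hL : LinearMap.det (B.toLpLin 2 2) ≠ 0 := by rwa [LinearMap.det_toLpLin]
  rw [integral_comp_linearMap_eq volume hL (fun y => Real.exp (-(1 / 2) * ‖y‖ ^ 2)),
    GaussianFourier.integral_rexp_neg_mul_sq_norm (by norm_num), LinearMap.det_toLpLin,
    finrank_euclideanSpace_fin, mul_comm, hdet, ← sq_abs B.det, ← Real.rpow_natCast,
    ← Real.rpow_mul (abs_nonneg _), abs_inv]
  norm_num [Real.rpow_neg_one]
  left
  ring_nf

lemma gaussianDensity_pos {m : ℕ} (μ : EuclideanSpace ℝ (Fin m))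
    {S : Matrix (Fin m) (Fin m) ℝ} (hS : S.PosDef) (x : EuclideanSpace ℝ (Fin m)) :
    0 < gaussianDensity μ S x := by
  have := hS.det_pos
  unfold gaussianDensity
  positivity

lemma log_gaussianDensity {m : ℕ} (μ : EuclideanSpace ℝ (Fin m))
    {S : Matrix (Fin m) (Fin m) ℝ} (hS : S.PosDef) (x : EuclideanSpace ℝ (Fin m)) :
    Real.log (gaussianDensity μ S x) =
      -(1 / 2) * (m * Real.log (2 * Real.pi) + Real.log S.det) -
        1 / 2 * ∑ i, ∑ j, S⁻¹ i j * ((x i - μ i) * (x j - μ j)) := by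
  have hd := hS.det_pos
  have hpi : (0 : ℝ) < 2 * Real.pi := by positivity
  unfold gaussianDensity
  rw [Real.log_mul (by positivity) (by positivity), Real.log_mul (by positivity) (by positivity),
    Real.log_rpow hpi, Real.log_rpow hd, Real.log_exp]
  have : (fun i => x i - μ i) ⬝ᵥ (S⁻¹ *ᵥ fun i => x i - μ i) =
      ∑ i, ∑ j, S⁻¹ i j * ((x i - μ i) * (x j - μ j)) := by
    simp only [dotProduct, mulVec, Finset.mul_sum]
    exact Finset.sum_congr rfl fun i _ => Finset.sum_congr rfl fun j _ => by ring
  rw [this]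
  ring

lemma integral_gaussianDensity {m : ℕ} (μ : EuclideanSpace ℝ (Fin m))
    {S : Matrix (Fin m) (Fin m) ℝ} (hS : S.PosDef) : ∫ x, gaussianDensity μ S x = 1 := by
  have hd := hS.det_pos
  have hpi : (0 : ℝ) < 2 * Real.pi := by positivity
  unfold gaussianDensity
  rw [integral_const_mul]
  have hshift := integral_sub_right_eq_self (μ := volume)
    (fun y : EuclideanSpace ℝ (Fin m) => Real.exp (-(1 / 2) * (y.ofLp ⬝ᵥ (S⁻¹ *ᵥ y.ofLp)))) μ
  have hint := hshift.trans (integral_exp_neg_half_quadratic hS.inv)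
  change ∫ x : EuclideanSpace ℝ (Fin m), Real.exp (-(1 / 2) *
    ((fun i => x i - μ i) ⬝ᵥ (S⁻¹ *ᵥ fun i => x i - μ i))) = _ at hint
  rw [hint, det_nonsing_inv, Ring.inverse_eq_inv', Real.inv_rpow hd.le, mul_mul_mul_comm,
    mul_inv_cancel₀ (by positivity), neg_div, Real.rpow_neg hpi.le,
    inv_mul_cancel₀ (by positivity), one_mul]

/-- Gibbs' inequality for densities, with its equality case. -/
lemma neg_integral_mul_log_le_and_eq_iff {α : Type*} [MeasurableSpace α] {ν : Measure α}
    {f g : α → ℝ} (hf : ∀ x, 0 ≤ f x) (hg : ∀ x, 0 < g x) (hfi : Integrable f ν)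
    (hgi : Integrable g ν) (hfg : ∫ x, f x ∂ν = ∫ x, g x ∂ν)
    (hff : Integrable (fun x => f x * Real.log (f x)) ν)
    (hflg : Integrable (fun x => f x * Real.log (g x)) ν) :
    -∫ x, f x * Real.log (f x) ∂ν ≤ -∫ x, f x * Real.log (g x) ∂ν ∧
      (-∫ x, f x * Real.log (f x) ∂ν = -∫ x, f x * Real.log (g x) ∂ν ↔ f =ᵐ[ν] g) := by
  have hkl (x : α) : f x * Real.log (f x) - f x * Real.log (g x) + (g x - f x) =
      g x * InformationTheory.klFun (f x / g x) := by
    have hgx := (hg x).ne'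
    rw [InformationTheory.klFun_apply]
    rcases (hf x).eq_or_lt with h | h
    · simp [← h]
    · rw [Real.log_div h.ne' hgx]
      field_simp
      ring
  have hratio (x : α) : 0 ≤ f x / g x := div_nonneg (hf x) (hg x).le
  have hnonneg : 0 ≤ fun x => g x * InformationTheory.klFun (f x / g x) := fun x =>
    mul_nonneg (hg x).le (InformationTheory.klFun_nonneg (hratio x))
  have hint : Integrable (fun x => g x * InformationTheory.klFun (f x / g x)) ν :=
    ((hff.sub hflg).add (hgi.sub hfi)).congr (.of_forall hkl)
  have hval : ∫ x, g x * InformationTheory.klFun (f x / g x) ∂ν =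
      ∫ x, f x * Real.log (f x) ∂ν - ∫ x, f x * Real.log (g x) ∂ν := by
    simp_rw [← hkl]
    have hadd := integral_add (hff.sub hflg) (hgi.sub hfi)
    simp only [Pi.sub_apply] at hadd
    rw [hadd, integral_sub hff hflg, integral_sub hgi hfi, hfg, sub_self, add_zero]
  refine ⟨by linarith [integral_nonneg (μ := ν) hnonneg], ?_⟩
  have hzero := integral_eq_zero_iff_of_nonneg hnonneg hint
  rw [hval, sub_eq_zero] at hzero
  rw [neg_inj, hzero]
  refine eventually_congr (.of_forall fun x => ?_)
  simp only [Pi.zero_apply, mul_eq_zero, (hg x).ne', false_or,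
    InformationTheory.klFun_eq_zero_iff (hratio x), div_eq_one_iff_eq (hg x).ne']

/-- The cross entropy of a density relative to the Gaussian with the same covariance. -/
lemma integral_mul_log_gaussianDensity {m : ℕ} {f : EuclideanSpace ℝ (Fin m) → ℝ}
    {μ : EuclideanSpace ℝ (Fin m)} {S : Matrix (Fin m) (Fin m) ℝ}
    (hf : IsDensity f) (hcov : HasCov f μ S) (hS : S.PosDef) :
    Integrable (fun x => f x * Real.log (gaussianDensity μ S x)) ∧
      -∫ x, f x * Real.log (gaussianDensity μ S x) =
        (1 / 2) * Real.log ((2 * Real.pi * Real.exp 1) ^ m * S.det) := by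
  obtain ⟨-, -, hfi, hf1⟩ := hf
  have hd := hS.det_pos
  have hpi : (0 : ℝ) < 2 * Real.pi := by positivity
  set c : ℝ := -(1 / 2) * (m * Real.log (2 * Real.pi) + Real.log S.det) with hc
  have hexpand (x : EuclideanSpace ℝ (Fin m)) : f x * Real.log (gaussianDensity μ S x) =
      f x * c - 1 / 2 * ∑ i, ∑ j, S⁻¹ i j * (f x * ((x i - μ i) * (x j - μ j))) := by
    rw [log_gaussianDensity μ hS, mul_sub, ← hc, mul_left_comm, Finset.mul_sum]
    simp_rw [Finset.mul_sum, mul_left_comm (f x)]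
  have hterm (i j : Fin m) : Integrable fun x : EuclideanSpace ℝ (Fin m) =>
      S⁻¹ i j * (f x * ((x i - μ i) * (x j - μ j))) := (hcov.1 i j).const_mul _
  have hrow (i : Fin m) := integrable_finsetSum Finset.univ fun j _ => hterm i j
  have hquad := integrable_finsetSum Finset.univ fun i _ => hrow i
  have htrace : ∑ i, ∑ j, S⁻¹ i j * S i j = m := by
    have hsymm (i j : Fin m) : S i j = S j i := by simpa using hS.isHermitian.apply j i
    have hinv : S⁻¹ * S = 1 := nonsing_inv_mul _ hd.ne'.isUnit
    have : ∑ i, ∑ j, S⁻¹ i j * S i j = (S⁻¹ * S).trace := by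
      simp only [trace, diag_apply, mul_apply]
      exact Finset.sum_congr rfl fun i _ => Finset.sum_congr rfl fun j _ => by rw [hsymm i j]
    rw [this, hinv, trace_one, Fintype.card_fin]
  simp_rw [hexpand]
  refine ⟨(hfi.mul_const c).sub (hquad.const_mul _), ?_⟩
  rw [integral_sub (hfi.mul_const c) (hquad.const_mul _), integral_mul_const, hf1,
    integral_const_mul, integral_finsetSum _ fun i _ => hrow i]
  simp_rw [integral_finsetSum _ fun j _ => hterm _ j, integral_const_mul, hcov.2, htrace]
  rw [Real.log_mul (by positivity) hd.ne', Real.log_pow, Real.log_mul hpi.ne' (by positivity),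
    Real.log_exp, hc]
  ring

/-- maximum entropy property of the Gaussian: for any density `f`
with mean `μ` and symmetric positive definite covariance `Σ`,
`H(f) ≤ (1/2) log ((2πe)^m det Σ)`, with equality iff `f = φ_{μ,Σ}` a.e. -/
theorem gaussian_maximum_entropy {m : ℕ} (f : EuclideanSpace ℝ (Fin m) → ℝ)
    (μ : EuclideanSpace ℝ (Fin m)) (S : Matrix (Fin m) (Fin m) ℝ)
    (hf : IsDensity f) (hmean : HasMean f μ) (hcov : HasCov f μ S) (hS : S.PosDef)
    (hH : Integrable fun x => f x * Real.log (f x)) :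
    shannonEntropy f ≤ (1 / 2) * Real.log ((2 * Real.pi * Real.exp 1) ^ m * S.det) ∧
      (shannonEntropy f = (1 / 2) * Real.log ((2 * Real.pi * Real.exp 1) ^ m * S.det) ↔
        f =ᵐ[volume] gaussianDensity μ S) := by
  obtain ⟨hint, hval⟩ := integral_mul_log_gaussianDensity hf hcov hS
  have hg := integral_gaussianDensity μ hS
  rw [← hval]
  exact neg_integral_mul_log_le_and_eq_iff hf.2.1 (gaussianDensity_pos μ hS) hf.2.2.1
    (integrable_of_integral_eq_one hg) (hf.2.2.2.trans hg.symm) hH hint
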